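/- For M̄ > 0, the total phase-space integral of the angle-averaged cosine vanishes: ∫∫_{(-π,π]×ℝ} ⟨cos q⟩_J dq dp = 0, where ⟨cos q⟩_J equals 2E(k)/K(k) − 1 for k < 1 and 2k²E(1/k)/K(1/k) − 2k² + 1 for k > 1, with k² = (p² + 2M̄(1−cos q))/(4M̄). -/

import Mathlib

open Real MeasureTheory

noncomputable def ellK (k : ℝ) : ℝ :=
  ∫ φ in (0:ℝ)..(Real.pi/2), 1 / Real.sqrt (1 - k^2 * Real.sin φ ^ 2)

noncomputable def ellE (k : ℝ) : ℝ :=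
  ∫ φ in (0:ℝ)..(Real.pi/2), Real.sqrt (1 - k^2 * Real.sin φ ^ 2)

noncomputable def modk (M q p : ℝ) : ℝ :=
  Real.sqrt ((p^2 + 2*M*(1 - Real.cos q)) / (4*M))

noncomputable def avgcos (M q p : ℝ) : ℝ :=
  if modk M q p < 1 then 2 * ellE (modk M q p) / ellK (modk M q p) - 1
  else 2 * (modk M q p)^2 * ellE (1 / modk M q p) / ellK (1 / modk M q p)
    - 2 * (modk M q p)^2 + 1

open Set Filter Topology

/-- The angle average of `cos q` on the orbit of modulus `k`. -/
noncomputable def orbitAvg (k : ℝ) : ℝ :=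
  if k < 1 then 2 * ellE k / ellK k - 1
  else 2 * k ^ 2 * ellE (1 / k) / ellK (1 / k) - 2 * k ^ 2 + 1

lemma avgcos_eq_orbitAvg (M q p : ℝ) : avgcos M q p = orbitAvg (modk M q p) := rfl

lemma one_sub_sq_mul_sin_sq_pos {m : ℝ} (hm0 : 0 ≤ m) (hm : m < 1) (φ : ℝ) :
    0 < 1 - m ^ 2 * sin φ ^ 2 := by
  nlinarith [sin_sq_le_one φ, sq_nonneg (sin φ), mul_self_nonneg m]

lemma continuous_one_div_sqrt_ell {m : ℝ} (hm0 : 0 ≤ m) (hm : m < 1) :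
    Continuous fun φ => 1 / √(1 - m ^ 2 * sin φ ^ 2) :=
  continuous_const.div (by fun_prop)
    fun φ => (sqrt_pos.2 (one_sub_sq_mul_sin_sq_pos hm0 hm φ)).ne'

lemma ellK_pos {m : ℝ} (hm0 : 0 ≤ m) (hm : m < 1) : 0 < ellK m := by
  refine intervalIntegral.intervalIntegral_pos_of_pos
    ((continuous_one_div_sqrt_ell hm0 hm).intervalIntegrable _ _) (fun φ => ?_) (by positivity)
  exact one_div_pos.2 (sqrt_pos.2 (one_sub_sq_mul_sin_sq_pos hm0 hm φ))

lemma integral_even_symm {g : ℝ → ℝ} (hg : Continuous g) (he : ∀ x, g (-x) = g x) (a : ℝ) :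
    ∫ x in (-a)..a, g x = 2 * ∫ x in (0 : ℝ)..a, g x := by
  have h : ∫ x in (-a)..0, g x = ∫ x in (0 : ℝ)..a, g x := by
    have := intervalIntegral.integral_comp_neg (a := 0) (b := a) g
    simpa [he] using this.symm
  rw [← intervalIntegral.integral_add_adjacent_intervals
    (hg.intervalIntegrable (-a) 0) (hg.intervalIntegrable 0 a), h, two_mul]

lemma integral_combination_ellK_ellE {m : ℝ} (hm0 : 0 ≤ m) (hm : m < 1) (a b : ℝ) :
    ∫ φ in (-(π / 2))..(π / 2),
      (a * (1 / √(1 - m ^ 2 * sin φ ^ 2)) - b * √(1 - m ^ 2 * sin φ ^ 2)) =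
      2 * (a * ellK m - b * ellE m) := by
  have hK := continuous_one_div_sqrt_ell hm0 hm
  have hE : Continuous fun φ => √(1 - m ^ 2 * sin φ ^ 2) := by fun_prop
  have hC : Continuous fun φ =>
      a * (1 / √(1 - m ^ 2 * sin φ ^ 2)) - b * √(1 - m ^ 2 * sin φ ^ 2) :=
    (hK.const_mul a).sub (hE.const_mul b)
  rw [integral_even_symm hC (by simp),
    intervalIntegral.integral_sub ((hK.const_mul a).intervalIntegrable _ _)
      ((hE.const_mul b).intervalIntegrable _ _),
    intervalIntegral.integral_const_mul, intervalIntegral.integral_const_mul]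
  rfl

lemma cos_eq_one_sub_two_mul_sin_half_sq (q : ℝ) : cos q = 1 - 2 * sin (q / 2) ^ 2 := by
  have := cos_two_mul (q / 2)
  rw [mul_div_cancel₀ q two_ne_zero] at this
  linarith [sin_sq_add_cos_sq (q / 2)]

lemma section_integral_of_one_lt {k : ℝ} (hk : 1 < k) :
    ∫ q in {q | q ∈ Ioc (-π) π ∧ sin (q / 2) ^ 2 < k ^ 2},
      (1 / √(k ^ 2 - sin (q / 2) ^ 2)) * (orbitAvg k - cos q) = 0 := by
  have hk0 : 0 < k := by linarith
  have hset : {q | q ∈ Ioc (-π) π ∧ sin (q / 2) ^ 2 < k ^ 2} = Ioc (-π) π := by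
    ext q
    simp only [mem_ofPred_eq, and_iff_left_iff_imp]
    intro _
    nlinarith [sin_sq_le_one (q / 2)]
  have hm0 : 0 ≤ 1 / k := by positivity
  have hm : 1 / k < 1 := by rw [div_lt_one hk0]; exact hk
  have hfun : ∀ q : ℝ, (1 / √(k ^ 2 - sin (q / 2) ^ 2)) * (orbitAvg k - cos q) =
      (fun φ => (orbitAvg k - 1 + 2 * k ^ 2) / k * (1 / √(1 - (1 / k) ^ 2 * sin φ ^ 2)) -
        2 * k * √(1 - (1 / k) ^ 2 * sin φ ^ 2)) (q / 2) := by
    intro q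
    have hpos := one_sub_sq_mul_sin_sq_pos hm0 hm (q / 2)
    have hs : √(k ^ 2 - sin (q / 2) ^ 2) = k * √(1 - (1 / k) ^ 2 * sin (q / 2) ^ 2) := by
      rw [show k ^ 2 - sin (q / 2) ^ 2 = k ^ 2 * (1 - (1 / k) ^ 2 * sin (q / 2) ^ 2) by
        field_simp, sqrt_mul (by positivity), sqrt_sq hk0.le]
    have hsq := sq_sqrt hpos.le
    have hne := (sqrt_pos.2 hpos).ne'
    simp only [hs, cos_eq_one_sub_two_mul_sin_half_sq q]
    set w := √(1 - (1 / k) ^ 2 * sin (q / 2) ^ 2)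
    have h2 : sin (q / 2) ^ 2 = k ^ 2 * (1 - w ^ 2) := by
      rw [hsq]; field_simp; ring
    rw [h2]; field_simp; ring
  rw [hset, ← intervalIntegral.integral_of_le (by linarith [pi_pos])]
  rw [intervalIntegral.integral_congr fun q _ => hfun q]
  refine (intervalIntegral.integral_comp_div (a := -π) (b := π) (fun φ =>
    (orbitAvg k - 1 + 2 * k ^ 2) / k * (1 / √(1 - (1 / k) ^ 2 * sin φ ^ 2)) -
      2 * k * √(1 - (1 / k) ^ 2 * sin φ ^ 2)) two_ne_zero).trans ?_
  rw [neg_div, integral_combination_ellK_ellE hm0 hm, orbitAvg, if_neg (by linarith)]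
  have := (ellK_pos hm0 hm).ne'
  simp only [smul_eq_mul]
  field_simp
  ring

lemma section_integral_of_lt_one {k : ℝ} (hk0 : 0 < k) (hk : k < 1) :
    ∫ q in {q | q ∈ Ioc (-π) π ∧ sin (q / 2) ^ 2 < k ^ 2},
      (1 / √(k ^ 2 - sin (q / 2) ^ 2)) * (orbitAvg k - cos q) = 0 := by
  have hb : ∀ θ : ℝ, -1 < k * sin θ ∧ k * sin θ < 1 := fun θ => by
    constructor <;> nlinarith [sin_le_one θ, neg_one_le_sin θ]
  have hsin : ∀ θ : ℝ, sin (2 * arcsin (k * sin θ) / 2) = k * sin θ := fun θ => by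
    rw [mul_div_cancel_left₀ _ two_ne_zero, sin_arcsin (hb θ).1.le (hb θ).2.le]
  have himage : {q | q ∈ Ioc (-π) π ∧ sin (q / 2) ^ 2 < k ^ 2} =
      (fun θ => 2 * arcsin (k * sin θ)) '' Ioo (-(π / 2)) (π / 2) := by
    ext q
    constructor
    · rintro ⟨⟨h1, h2⟩, h3⟩
      have h4 := abs_lt.1 (abs_lt_of_sq_lt_sq h3 hk0.le)
      have h5 : -1 < sin (q / 2) / k := by rw [lt_div_iff₀ hk0]; linarith
      have h6 : sin (q / 2) / k < 1 := by rw [div_lt_iff₀ hk0]; linarith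
      refine ⟨arcsin (sin (q / 2) / k), ⟨neg_pi_div_two_lt_arcsin.2 h5,
        arcsin_lt_pi_div_two.2 h6⟩, ?_⟩
      simp only
      rw [sin_arcsin h5.le h6.le, mul_div_cancel₀ _ hk0.ne', arcsin_sin (by linarith) (by linarith)]
      ring
    · rintro ⟨θ, hθ, rfl⟩
      have h1 := neg_pi_div_two_lt_arcsin.2 (hb θ).1
      have h2 := arcsin_lt_pi_div_two.2 (hb θ).2
      refine ⟨⟨by simp only; linarith, by simp only; linarith⟩, ?_⟩
      have hc := cos_pos_of_mem_Ioo hθ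
      simp only [hsin]
      nlinarith [sin_sq_add_cos_sq θ, mul_pos hk0 hk0, mul_pos hc hc,
        mul_pos (mul_pos hk0 hk0) (mul_pos hc hc)]
  have hderiv : ∀ θ ∈ Ioo (-(π / 2)) (π / 2),
      HasDerivWithinAt (fun θ => 2 * arcsin (k * sin θ))
        (2 * (1 / √(1 - (k * sin θ) ^ 2) * (k * cos θ))) (Ioo (-(π / 2)) (π / 2)) θ := by
    intro θ _
    exact (((hasDerivAt_arcsin (hb θ).1.ne' (hb θ).2.ne).comp θ
      ((hasDerivAt_sin θ).const_mul k)).const_mul 2).hasDerivWithinAt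
  have hinj : InjOn (fun θ => 2 * arcsin (k * sin θ)) (Ioo (-(π / 2)) (π / 2)) := by
    intro x hx y hy hxy
    have h : k * sin x = k * sin y := by
      rw [← hsin x, ← hsin y]
      exact congrArg (fun t => sin (t / 2)) hxy
    exact injOn_sin (Ioo_subset_Icc_self hx) (Ioo_subset_Icc_self hy)
      (mul_left_cancel₀ hk0.ne' h)
  rw [himage, integral_image_eq_integral_abs_deriv_smul measurableSet_Ioo hderiv hinj,
    setIntegral_congr_fun (g := fun θ => 2 * (orbitAvg k + 1) * (1 / √(1 - k ^ 2 * sin θ ^ 2)) -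
      4 * √(1 - k ^ 2 * sin θ ^ 2)) measurableSet_Ioo, ← integral_Ioc_eq_integral_Ioo,
    ← intervalIntegral.integral_of_le (by linarith [pi_pos]),
    integral_combination_ellK_ellE hk0.le hk, orbitAvg, if_pos hk]
  · have := (ellK_pos hk0.le hk).ne'
    field_simp
    ring
  · intro θ hθ
    have hc := cos_pos_of_mem_Ioo hθ
    have hpos := one_sub_sq_mul_sin_sq_pos hk0.le hk θ
    have hsq := sq_sqrt hpos.le
    have hw := sqrt_pos.2 hpos
    have hs : √(k ^ 2 - (k * sin θ) ^ 2) = k * cos θ := by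
      rw [← sqrt_sq (mul_pos hk0 hc).le]
      congr 1
      rw [mul_pow, mul_pow, cos_sq']
      ring
    simp only [cos_eq_one_sub_two_mul_sin_half_sq (2 * arcsin (k * sin θ)), hsin, hs, smul_eq_mul]
    rw [mul_pow]
    set w := √(1 - k ^ 2 * sin θ ^ 2)
    rw [abs_of_pos (by positivity)]
    have h2 : k ^ 2 * sin θ ^ 2 = 1 - w ^ 2 := by rw [hsq]; ring
    rw [h2]
    field_simp
    ring

/-- The coordinates `(q, k) ↦ (q, p)` on phase space, where `k` is the modulus; the sign of `c`
selects the half plane. -/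
noncomputable def ofModulus (c : ℝ) (x : ℝ × ℝ) : ℝ × ℝ :=
  (x.1, c * √(x.2 ^ 2 - sin (x.1 / 2) ^ 2))

/-- The derivative of `ofModulus`. -/
noncomputable def fderivOfModulus (c : ℝ) (x : ℝ × ℝ) : ℝ × ℝ →L[ℝ] ℝ × ℝ :=
  (Matrix.toLin (.finTwoProd ℝ) (.finTwoProd ℝ)
    !![1, 0; c * (-(sin (x.1 / 2) * cos (x.1 / 2)) / (2 * √(x.2 ^ 2 - sin (x.1 / 2) ^ 2))),
      c * x.2 / √(x.2 ^ 2 - sin (x.1 / 2) ^ 2)]).toContinuousLinearMap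

lemma det_fderivOfModulus (c : ℝ) (x : ℝ × ℝ) :
    (fderivOfModulus c x).det = c * x.2 / √(x.2 ^ 2 - sin (x.1 / 2) ^ 2) := by
  unfold fderivOfModulus
  simp only [LinearMap.det_toContinuousLinearMap, LinearMap.det_toLin, Matrix.det_fin_two_of]
  ring

lemma hasFDerivAt_ofModulus (c : ℝ) {x : ℝ × ℝ} (hx : sin (x.1 / 2) ^ 2 < x.2 ^ 2) :
    HasFDerivAt (ofModulus c) (fderivOfModulus c x) x := by
  have hpos : 0 < x.2 ^ 2 - sin (x.1 / 2) ^ 2 := by linarith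
  have hsin : HasDerivAt (fun q : ℝ => sin (q / 2) ^ 2) (sin (x.1 / 2) * cos (x.1 / 2)) x.1 := by
    have h := ((hasDerivAt_id x.1).div_const 2).sin.pow 2
    refine h.congr_deriv ?_
    simp only [id]
    ring
  have hsq : HasDerivAt (fun k : ℝ => k ^ 2) (2 * x.2) x.2 := by
    simpa using hasDerivAt_pow 2 x.2
  have h1 : HasFDerivAt (fun y : ℝ × ℝ => y.2 ^ 2 - sin (y.1 / 2) ^ 2) _ x :=
    (hsq.comp_hasFDerivAt x (hasFDerivAt_snd (𝕜 := ℝ))).sub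
      (hsin.comp_hasFDerivAt x (hasFDerivAt_fst (𝕜 := ℝ)))
  have h2 := (h1.sqrt hpos.ne').const_mul c
  unfold fderivOfModulus
  rw [Matrix.toLin_finTwoProd_toContinuousLinearMap]
  have hs := (sqrt_pos.2 hpos).ne'
  refine (hasFDerivAt_fst.prodMk h2).congr_fderiv ?_
  ext <;> simp <;> field_simp

lemma modk_nonneg (M q p : ℝ) : 0 ≤ modk M q p := sqrt_nonneg _

lemma modk_sq {M : ℝ} (hM : 0 < M) (q p : ℝ) :
    modk M q p ^ 2 = p ^ 2 / (4 * M) + sin (q / 2) ^ 2 := by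
  have h : (p ^ 2 + 2 * M * (1 - cos q)) / (4 * M) = p ^ 2 / (4 * M) + sin (q / 2) ^ 2 := by
    rw [cos_eq_one_sub_two_mul_sin_half_sq]
    field_simp
    ring
  rw [modk, h, sq_sqrt (by positivity)]

lemma continuous_modk (M : ℝ) : Continuous fun x : ℝ × ℝ => modk M x.1 x.2 := by
  unfold modk
  fun_prop

lemma modk_ofModulus {M c : ℝ} (hM : 0 < M) (hc : c ^ 2 = 4 * M) {x : ℝ × ℝ} (hx0 : 0 < x.2)
    (hx : sin (x.1 / 2) ^ 2 < x.2 ^ 2) :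
    modk M (ofModulus c x).1 (ofModulus c x).2 = x.2 := by
  rw [← sq_eq_sq₀ (modk_nonneg _ _ _) hx0.le, modk_sq hM]
  simp only [ofModulus]
  rw [mul_pow, sq_sqrt (by linarith), hc]
  field_simp
  ring

/-- The part of phase space of modulus less than `R`, in the coordinates `(q, k)`. -/
def modulusRegion (R : ℝ) : Set (ℝ × ℝ) :=
  {x | x.1 ∈ Ioc (-π) π ∧ (0 < x.2 ∧ x.2 < R) ∧ sin (x.1 / 2) ^ 2 < x.2 ^ 2}

lemma measurableSet_modulusRegion (R : ℝ) : MeasurableSet (modulusRegion R) := by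
  have h : MeasurableSet {x : ℝ × ℝ | sin (x.1 / 2) ^ 2 < x.2 ^ 2} :=
    measurableSet_lt (by fun_prop) (by fun_prop)
  exact (measurableSet_Ioc.preimage measurable_fst).inter
    ((measurableSet_Ioo.preimage measurable_snd).inter h)

lemma image_ofModulus {M c : ℝ} (hM : 0 < M) (hc : c ^ 2 = 4 * M) (R : ℝ) :
    ofModulus c '' modulusRegion R =
      {y | y.1 ∈ Ioc (-π) π ∧ modk M y.1 y.2 < R ∧ 0 < c * y.2} := by
  have hc0 : 0 < c ^ 2 := by rw [hc]; positivity
  have hcne : c ≠ 0 := by rintro rfl; simp at hc0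
  ext y
  constructor
  · rintro ⟨x, ⟨h1, ⟨h2, h3⟩, h4⟩, rfl⟩
    refine ⟨h1, by rwa [modk_ofModulus hM hc h2 h4], ?_⟩
    have := sqrt_pos.2 (sub_pos.2 h4)
    simp only [ofModulus]
    nlinarith [mul_pos hc0 this]
  · rintro ⟨h1, h2, h3⟩
    have hy : 0 < y.2 ^ 2 / (4 * M) := by
      have : y.2 ≠ 0 := by rintro h; simp [h] at h3
      positivity
    have hk := modk_sq hM y.1 y.2
    have hk0 : 0 < modk M y.1 y.2 := by
      refine lt_of_le_of_ne (modk_nonneg _ _ _) fun h => ?_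
      rw [← h] at hk
      nlinarith [sq_nonneg (sin (y.1 / 2))]
    refine ⟨(y.1, modk M y.1 y.2), ⟨h1, ⟨hk0, h2⟩, by simp only; linarith⟩, ?_⟩
    refine Prod.ext rfl ?_
    simp only [ofModulus]
    rw [hk, add_sub_cancel_right, ← hc, ← div_pow, sqrt_sq_eq_abs, abs_of_pos, mul_div_cancel₀ _ hcne]
    rw [← mul_div_mul_left _ c hcne, ← sq]
    positivity

lemma injOn_ofModulus {M c : ℝ} (hM : 0 < M) (hc : c ^ 2 = 4 * M) (R : ℝ) :
    InjOn (ofModulus c) (modulusRegion R) := by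
  rintro x ⟨-, ⟨hx, -⟩, hx'⟩ y ⟨-, ⟨hy, -⟩, hy'⟩ hxy
  have hfst : (ofModulus c x).1 = (ofModulus c y).1 := by rw [hxy]
  refine Prod.ext hfst ?_
  rw [← modk_ofModulus hM hc hx hx', ← modk_ofModulus hM hc hy hy', hxy]

lemma integral_avgcos_sub_cos_halfPlane {M c : ℝ} (hM : 0 < M) (hc : c ^ 2 = 4 * M) (R : ℝ)
    (hint : IntegrableOn (fun y : ℝ × ℝ => avgcos M y.1 y.2 - cos y.1)
      {y | y.1 ∈ Ioc (-π) π ∧ modk M y.1 y.2 < R ∧ 0 < c * y.2}) :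
    ∫ y in {y : ℝ × ℝ | y.1 ∈ Ioc (-π) π ∧ modk M y.1 y.2 < R ∧ 0 < c * y.2},
      (avgcos M y.1 y.2 - cos y.1) = 0 := by
  have hmeas := measurableSet_modulusRegion R
  have hderiv : ∀ x ∈ modulusRegion R,
      HasFDerivWithinAt (ofModulus c) (fderivOfModulus c x) (modulusRegion R) x :=
    fun x hx => (hasFDerivAt_ofModulus c hx.2.2).hasFDerivWithinAt
  have hinj := injOn_ofModulus hM hc R
  rw [← image_ofModulus hM hc] at hint ⊢
  rw [integrableOn_image_iff_integrableOn_abs_det_fderiv_smul volume hmeas hderiv hinj] at hint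
  rw [integral_image_eq_integral_abs_det_fderiv_smul volume hmeas hderiv hinj,
    ← integral_indicator hmeas]
  rw [← integrable_indicator_iff hmeas] at hint
  rw [Measure.volume_eq_prod] at hint ⊢
  rw [integral_prod_symm _ hint]
  refine integral_eq_zero_of_ae ?_
  have hne : ∀ᵐ k : ℝ, k ≠ 1 := by simp [ae_iff]
  filter_upwards [hne] with k hk1
  simp only [Pi.zero_apply]
  by_cases hk : 0 < k ∧ k < R
  · have hsm : MeasurableSet {q : ℝ | q ∈ Ioc (-π) π ∧ sin (q / 2) ^ 2 < k ^ 2} := by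
      have h : MeasurableSet {q : ℝ | sin (q / 2) ^ 2 < k ^ 2} :=
        measurableSet_lt (by fun_prop) (by fun_prop)
      exact measurableSet_Ioc.inter h
    have hsec : ∀ q : ℝ, (modulusRegion R).indicator (fun x => |(fderivOfModulus c x).det| •
        (avgcos M (ofModulus c x).1 (ofModulus c x).2 - cos (ofModulus c x).1)) (q, k) =
        {q : ℝ | q ∈ Ioc (-π) π ∧ sin (q / 2) ^ 2 < k ^ 2}.indicator (fun q =>
          |c * k| * ((1 / √(k ^ 2 - sin (q / 2) ^ 2)) * (orbitAvg k - cos q))) q := by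
      intro q
      by_cases hq : q ∈ Ioc (-π) π ∧ sin (q / 2) ^ 2 < k ^ 2
      · have hmem : (q, k) ∈ modulusRegion R := ⟨hq.1, hk, hq.2⟩
        have hmem' : q ∈ {q : ℝ | q ∈ Ioc (-π) π ∧ sin (q / 2) ^ 2 < k ^ 2} := hq
        have hmod : modk M (ofModulus c (q, k)).1 (ofModulus c (q, k)).2 = k :=
          modk_ofModulus hM hc hk.1 hq.2
        rw [indicator_of_mem hmem, indicator_of_mem hmem', det_fderivOfModulus,
          avgcos_eq_orbitAvg, hmod, abs_div,
          abs_of_nonneg (sqrt_nonneg _), smul_eq_mul]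
        simp only [ofModulus]
        ring
      · have hmem : (q, k) ∉ modulusRegion R := fun h => hq ⟨h.1, h.2.2⟩
        have hmem' : q ∉ {q : ℝ | q ∈ Ioc (-π) π ∧ sin (q / 2) ^ 2 < k ^ 2} := hq
        rw [indicator_of_notMem hmem, indicator_of_notMem hmem']
    simp_rw [hsec]
    rw [integral_indicator hsm, integral_const_mul]
    rcases lt_or_gt_of_ne hk1 with h | h
    · rw [section_integral_of_lt_one hk.1 h, mul_zero]
    · rw [section_integral_of_one_lt h, mul_zero]
  · refine integral_eq_zero_of_ae (Eventually.of_forall fun q => ?_)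
    exact indicator_of_notMem (fun h => hk h.2.1) _

/-- The part of phase space of modulus less than `R`. -/
def phaseRegion (M R : ℝ) : Set (ℝ × ℝ) :=
  {y | y.1 ∈ Ioc (-π) π ∧ modk M y.1 y.2 < R}

lemma measurableSet_phaseRegion (M R : ℝ) : MeasurableSet (phaseRegion M R) :=
  (measurableSet_Ioc.preimage measurable_fst).inter
    (measurableSet_lt (continuous_modk M).measurable measurable_const)

lemma mem_phaseRegion_iff {M R : ℝ} (hM : 0 < M) (hR : 1 < R) (q p : ℝ) :
    (q, p) ∈ phaseRegion M R ↔ q ∈ Ioc (-π) π ∧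
      p ∈ Ioo (-(2 * √M * √(R ^ 2 - sin (q / 2) ^ 2))) (2 * √M * √(R ^ 2 - sin (q / 2) ^ 2)) := by
  have hR' : 0 ≤ R ^ 2 - sin (q / 2) ^ 2 := by nlinarith [sin_sq_le_one (q / 2)]
  refine and_congr_right fun _ => ?_
  simp only
  rw [mem_Ioo, ← abs_lt, ← sq_lt_sq₀ (modk_nonneg _ _ _) (by linarith), modk_sq hM,
    ← sq_lt_sq₀ (abs_nonneg p) (by positivity), sq_abs, mul_pow, mul_pow, sq_sqrt hM.le,
    sq_sqrt hR', ← lt_sub_iff_add_lt, div_lt_iff₀ (by positivity)]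
  constructor <;> intro h <;> linarith

lemma integrableOn_cos_phaseRegion {M R : ℝ} (hM : 0 < M) (hR : 1 < R) :
    IntegrableOn (fun y : ℝ × ℝ => cos y.1) (phaseRegion M R) := by
  have hsub : phaseRegion M R ⊆ Icc (-π) π ×ˢ Icc (-(2 * √M * R)) (2 * √M * R) := by
    rintro ⟨q, p⟩ h
    rw [mem_phaseRegion_iff hM hR] at h
    have hle : 2 * √M * √(R ^ 2 - sin (q / 2) ^ 2) ≤ 2 * √M * R := by
      gcongr
      rw [sqrt_le_left (by linarith)]
      linarith [sq_nonneg (sin (q / 2))]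
    exact ⟨Ioc_subset_Icc_self h.1, by linarith [h.2.1], by linarith [h.2.2]⟩
  exact (ContinuousOn.integrableOn_compact (isCompact_Icc.prod isCompact_Icc)
    (by fun_prop)).mono_set hsub

lemma integral_cos_phaseRegion {M R : ℝ} (hM : 0 < M) (hR : 1 < R) :
    ∫ y in phaseRegion M R, cos y.1 =
      ∫ q in (-π)..π, 4 * √M * (cos q * √(R ^ 2 - sin (q / 2) ^ 2)) := by
  have hint := integrableOn_cos_phaseRegion hM hR
  have hmeas := measurableSet_phaseRegion M R
  rw [← integrable_indicator_iff hmeas] at hint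
  rw [← integral_indicator hmeas]
  rw [Measure.volume_eq_prod] at hint ⊢
  rw [integral_prod _ hint, intervalIntegral.integral_of_le (by linarith [pi_pos]),
    ← integral_indicator measurableSet_Ioc]
  congr 1
  ext q
  by_cases hq : q ∈ Ioc (-π) π
  · rw [indicator_of_mem hq]
    have h : ∀ p, (phaseRegion M R).indicator (fun y : ℝ × ℝ => cos y.1) (q, p) =
        (Ioo (-(2 * √M * √(R ^ 2 - sin (q / 2) ^ 2)))
          (2 * √M * √(R ^ 2 - sin (q / 2) ^ 2))).indicator (fun _ => cos q) p := by
      intro p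
      simp only [indicator, mem_phaseRegion_iff hM hR, hq, true_and]
    have h0 : 0 ≤ 2 * √M * √(R ^ 2 - sin (q / 2) ^ 2) := by positivity
    simp_rw [h]
    rw [integral_indicator measurableSet_Ioo, setIntegral_const, measureReal_def, volume_Ioo,
      ENNReal.toReal_ofReal (by linarith), smul_eq_mul]
    ring
  · rw [indicator_of_notMem hq]
    refine integral_eq_zero_of_ae (Eventually.of_forall fun p => ?_)
    exact indicator_of_notMem (fun h => hq h.1) _

lemma abs_integral_cos_phaseRegion_le {M R : ℝ} (hM : 0 < M) (hR : 1 < R) :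
    |∫ y in phaseRegion M R, cos y.1| ≤ 8 * π * √M / R := by
  have hR0 : 0 < R := by linarith
  have hshift : ∫ q in (-π)..π, 4 * √M * (cos q * √(R ^ 2 - sin (q / 2) ^ 2)) =
      ∫ q in (-π)..π, 4 * √M * (cos q * (√(R ^ 2 - sin (q / 2) ^ 2) - R)) := by
    have h0 : ∫ q in (-π)..π, 4 * √M * R * cos q = 0 := by
      simp
    rw [← sub_zero (∫ q in (-π)..π, 4 * √M * (cos q * √(R ^ 2 - sin (q / 2) ^ 2))), ← h0,
      ← intervalIntegral.integral_sub]
    · congr 1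
      ext q
      ring
    all_goals exact Continuous.intervalIntegrable (by fun_prop) _ _
  rw [integral_cos_phaseRegion hM hR, hshift, ← norm_eq_abs]
  have hbound : ∀ q ∈ uIoc (-π) π,
      ‖4 * √M * (cos q * (√(R ^ 2 - sin (q / 2) ^ 2) - R))‖ ≤ 4 * √M * (1 * (1 / R)) := by
    intro q _
    have hle : √(R ^ 2 - sin (q / 2) ^ 2) ≤ R := by
      rw [sqrt_le_left hR0.le]
      linarith [sq_nonneg (sin (q / 2))]
    have hge : R - 1 / R ≤ √(R ^ 2 - sin (q / 2) ^ 2) := by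
      apply le_sqrt_of_sq_le
      have h1 : 1 / R ≤ 1 := by rw [div_le_one hR0]; exact hR.le
      have h2 : 0 < 1 / R := by positivity
      have h3 : R * (1 / R) = 1 := by field_simp
      nlinarith [sin_sq_le_one (q / 2)]
    rw [norm_mul, norm_of_nonneg (by positivity : 0 ≤ 4 * √M), norm_mul]
    gcongr
    · exact abs_cos_le_one q
    · rw [norm_eq_abs, abs_of_nonpos (by linarith)]
      linarith
  refine (intervalIntegral.norm_integral_le_of_norm_le_const hbound).trans (le_of_eq ?_)
  rw [abs_of_pos (by linarith [pi_pos])]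
  field_simp
  ring

lemma integral_avgcos_phaseRegion {M R : ℝ} (hM : 0 < M) (hR : 1 < R)
    (hint : IntegrableOn (fun y : ℝ × ℝ => avgcos M y.1 y.2) (phaseRegion M R)) :
    ∫ y in phaseRegion M R, avgcos M y.1 y.2 = ∫ y in phaseRegion M R, cos y.1 := by
  have hcos := integrableOn_cos_phaseRegion hM hR
  have hdiff : IntegrableOn (fun y : ℝ × ℝ => avgcos M y.1 y.2 - cos y.1) (phaseRegion M R) :=
    hint.sub hcos
  rw [← sub_eq_zero, ← integral_sub hint hcos]
  have hpos : {y : ℝ × ℝ | y.1 ∈ Ioc (-π) π ∧ modk M y.1 y.2 < R ∧ 0 < 2 * √M * y.2} ⊆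
      phaseRegion M R := fun y h => ⟨h.1, h.2.1⟩
  have hneg : {y : ℝ × ℝ | y.1 ∈ Ioc (-π) π ∧ modk M y.1 y.2 < R ∧ 0 < -(2 * √M) * y.2} ⊆
      phaseRegion M R := fun y h => ⟨h.1, h.2.1⟩
  have hc : (2 * √M) ^ 2 = 4 * M := by rw [mul_pow, sq_sqrt hM.le]; norm_num
  have hMs : 0 < 2 * √M := by positivity
  have hae : (phaseRegion M R : Set (ℝ × ℝ)) =ᵐ[volume]
      ({y : ℝ × ℝ | y.1 ∈ Ioc (-π) π ∧ modk M y.1 y.2 < R ∧ 0 < 2 * √M * y.2} ∪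
      {y : ℝ × ℝ | y.1 ∈ Ioc (-π) π ∧ modk M y.1 y.2 < R ∧ 0 < -(2 * √M) * y.2} :
        Set (ℝ × ℝ)) := by
    have hne : ∀ᵐ y : ℝ × ℝ, y.2 ≠ 0 := by
      rw [Measure.volume_eq_prod]
      exact Measure.quasiMeasurePreserving_snd.ae (p := fun p : ℝ => p ≠ 0) (by simp [ae_iff])
    filter_upwards [hne] with y hy
    refine propext ⟨fun h => ?_, fun h => h.elim (@hpos y) (@hneg y)⟩
    rcases lt_or_gt_of_ne hy with h0 | h0
    · exact Or.inr ⟨h.1, h.2, by nlinarith⟩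
    · exact Or.inl ⟨h.1, h.2, by positivity⟩
  rw [setIntegral_congr_set hae, setIntegral_union _ _ (hdiff.mono_set hpos)
    (hdiff.mono_set hneg), integral_avgcos_sub_cos_halfPlane hM hc R (hdiff.mono_set hpos),
    integral_avgcos_sub_cos_halfPlane hM (by rw [neg_sq, hc]) R (hdiff.mono_set hneg), add_zero]
  · rw [Set.disjoint_left]
    rintro y ⟨-, -, h1⟩ ⟨-, -, h2⟩
    linarith
  · have h : MeasurableSet {y : ℝ × ℝ | 0 < -(2 * √M) * y.2} :=
      measurableSet_lt measurable_const (by fun_prop)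
    exact (measurableSet_Ioc.preimage measurable_fst).inter
      ((measurableSet_lt (continuous_modk M).measurable measurable_const).inter h)

theorem integral_avgcos_eq_zero (M : ℝ) (hM : 0 < M) :
    ∫ x in Set.Ioc (-π) π ×ˢ (Set.univ : Set ℝ), avgcos M x.1 x.2 = 0 := by
  by_cases hint : IntegrableOn (fun x : ℝ × ℝ => avgcos M x.1 x.2)
    (Set.Ioc (-π) π ×ˢ (Set.univ : Set ℝ))
  swap
  · exact integral_undef hint
  have hunion : ⋃ n : ℕ, phaseRegion M n = Set.Ioc (-π) π ×ˢ (Set.univ : Set ℝ) := by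
    ext y
    simp only [mem_iUnion, phaseRegion, mem_ofPred_eq, mem_prod, mem_univ, and_true]
    refine ⟨fun ⟨_, h⟩ => h.1, fun h => ?_⟩
    obtain ⟨n, hn⟩ := exists_nat_gt (modk M y.1 y.2)
    exact ⟨n, h, hn⟩
  rw [← hunion] at hint ⊢
  have hlim := tendsto_setIntegral_of_monotone
    (fun n : ℕ => measurableSet_phaseRegion M n)
    (fun m n hmn y hy => ⟨hy.1, hy.2.trans_le (Nat.cast_le.2 hmn)⟩) hint
  refine tendsto_nhds_unique hlim (squeeze_zero_norm' ?_
    (tendsto_const_div_atTop_nhds_zero_nat (8 * π * √M)))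
  filter_upwards [eventually_gt_atTop 1] with n hn
  have hn' : (1 : ℝ) < n := by exact_mod_cast hn
  rw [integral_avgcos_phaseRegion hM hn' (hint.mono_set (subset_iUnion_of_subset n subset_rfl))]
  exact abs_integral_cos_phaseRegion_le hM hn'
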